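/- arXiv:2503.07790 — 2 statements merged into one kernel-verified Lean document; each statement's English description precedes it below -/
import Mathlib

section
/- Let N, d, p be positive integers. Let g, r ∈ T(d,d), let f ∈ T(d+1,d), and let m ∈ ℤ[x] be a polynomial of degree < N all of whose coefficients have absolute value at most p/2. Then every coefficient of the polynomial p·(g ⋆ r) + f ⋆ m (computed in ℤ[x] as the degree < N representative modulo x^N − 1) has absolute value at most (3d + 1/2)·p = (6d+1)·p/2. In particular, if q > (6d+1)·p then every coefficient has absolute value strictly less than q/2. -/
open Polynomial

/-- The convolution product `a ⋆ b` in `R = ℤ[x]/(x^N − 1)`: the unique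
representative of degree < N of `a·b` modulo `x^N − 1`, i.e. the remainder
of `a·b` upon division by the monic polynomial `x^N − 1`. -/
noncomputable def conv (N : ℕ) (a b : ℤ[X]) : ℤ[X] :=
  (a * b) %ₘ (X ^ N - 1)

/-- `Tern N d₁ d₂ a` says `a` is a ternary polynomial in `T(d₁,d₂)`:
`a` has degree < N, exactly `d₁` coefficients equal to `1`, exactly `d₂`
coefficients equal to `−1`, and all other coefficients equal to `0`. -/
def Tern (N d₁ d₂ : ℕ) (a : ℤ[X]) : Prop :=
  a.degree < (N : WithBot ℕ) ∧
  ((Finset.range N).filter (fun i => a.coeff i = 1)).card = d₁ ∧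
  ((Finset.range N).filter (fun i => a.coeff i = -1)).card = d₂ ∧
  ∀ i, a.coeff i = 0 ∨ a.coeff i = 1 ∨ a.coeff i = -1

/-- `ModCong N q u v` is the congruence `u ≡ v (mod q, x^N − 1)`:
`u − v` lies in the ideal of `ℤ[x]` generated by `q` and `x^N − 1`. -/
def ModCong (N : ℕ) (q : ℤ) (u v : ℤ[X]) : Prop :=
  u - v ∈ Ideal.span ({C q, X ^ N - 1} : Set ℤ[X])

section CyclicConvolution

lemma monic_X_pow_sub_one {N : ℕ} (hN : 0 < N) : (X ^ N - 1 : ℤ[X]).Monic := by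
  simpa using monic_X_pow_sub_C (1 : ℤ) hN.ne'

lemma degree_X_pow_sub_one {N : ℕ} (hN : 0 < N) :
    (X ^ N - 1 : ℤ[X]).degree = (N : WithBot ℕ) := by
  simpa using degree_X_pow_sub_C hN (1 : ℤ)

lemma degree_conv_lt {N : ℕ} (hN : 0 < N) (a b : ℤ[X]) :
    (conv N a b).degree < (N : WithBot ℕ) := by
  rw [← degree_X_pow_sub_one hN]
  exact degree_modByMonic_lt _ (monic_X_pow_sub_one hN)

lemma conv_one {N : ℕ} (hN : 0 < N) {b : ℤ[X]} (hb : b.degree < (N : WithBot ℕ)) :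
    conv N 1 b = b := by
  rw [conv, one_mul, modByMonic_eq_self_iff (monic_X_pow_sub_one hN), degree_X_pow_sub_one hN]
  exact hb

/-- Multiplication by `X` modulo `X ^ N - 1` rotates the coefficients. -/
lemma conv_X {N : ℕ} (hN : 0 < N) {b : ℤ[X]} (hb : b.degree < (N : WithBot ℕ)) :
    conv N X b = X * b - C (b.coeff (N - 1)) * (X ^ N - 1) := by
  have hq := monic_X_pow_sub_one hN
  refine (div_modByMonic_unique (C (b.coeff (N - 1))) _ hq ⟨by ring, ?_⟩).2
  rw [degree_X_pow_sub_one hN, degree_lt_iff_coeff_zero]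
  intro k hk
  obtain ⟨j, rfl⟩ : ∃ j, k = j + 1 := ⟨k - 1, by omega⟩
  rw [coeff_sub, coeff_X_mul, coeff_C_mul, coeff_sub, coeff_X_pow, coeff_one,
    if_neg (by omega : ¬ j + 1 = 0)]
  split_ifs with h
  · simp [← h]
  · simp [coeff_eq_zero_of_degree_lt (hb.trans_le (Nat.cast_le.2 (by omega : N ≤ j)))]

lemma conv_X_mul {N : ℕ} (hN : 0 < N) (a b : ℤ[X]) :
    conv N (X * a) b = conv N X (conv N a b) := by
  have h : a * b %ₘ (X ^ N - 1) %ₘ (X ^ N - 1) = a * b %ₘ (X ^ N - 1) := by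
    simpa only [conv, one_mul] using conv_one hN (degree_conv_lt hN a b)
  rw [conv, conv, conv, mul_assoc, mul_modByMonic X (a * b), mul_modByMonic X (_ %ₘ _), h]

lemma abs_coeff_conv_X_le {N : ℕ} (hN : 0 < N) {b : ℤ[X]} (hb : b.degree < (N : WithBot ℕ))
    {M : ℤ} (hM : ∀ i, |b.coeff i| ≤ M) (k : ℕ) : |(conv N X b).coeff k| ≤ M := by
  by_cases hk : N ≤ k
  · rw [coeff_eq_zero_of_degree_lt ((degree_conv_lt hN X b).trans_le (Nat.cast_le.2 hk)), abs_zero]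
    exact (abs_nonneg _).trans (hM 0)
  rw [conv_X hN hb, coeff_sub, coeff_C_mul, coeff_sub, coeff_X_pow, coeff_one,
    if_neg (by omega : ¬ k = N)]
  cases k with
  | zero => simpa using hM (N - 1)
  | succ j => simpa [coeff_X_mul] using hM j

lemma abs_coeff_conv_X_pow_le {N : ℕ} (hN : 0 < N) {b : ℤ[X]}
    (hb : b.degree < (N : WithBot ℕ)) {M : ℤ} (hM : ∀ i, |b.coeff i| ≤ M) (n k : ℕ) :
    |(conv N (X ^ n) b).coeff k| ≤ M := by
  induction n generalizing k with
  | zero => rw [pow_zero, conv_one hN hb]; exact hM k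
  | succ n ih =>
    rw [pow_succ', conv_X_mul hN]
    exact abs_coeff_conv_X_le hN (degree_conv_lt hN _ b) ih k

lemma conv_eq_sum {N : ℕ} {a : ℤ[X]} (ha : a.degree < (N : WithBot ℕ)) (b : ℤ[X]) :
    conv N a b = ∑ i ∈ Finset.range N, a.coeff i • conv N (X ^ i) b := by
  have h : a = ∑ i ∈ Finset.range N, a.coeff i • (X : ℤ[X]) ^ i := by
    ext k
    simp only [finsetSum_coeff, coeff_smul, coeff_X_pow, smul_eq_mul, mul_ite, mul_one, mul_zero,
      Finset.sum_ite_eq, Finset.mem_range]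
    split_ifs with hk
    · rfl
    · exact coeff_eq_zero_of_degree_lt (ha.trans_le (Nat.cast_le.2 (not_lt.1 hk)))
  conv_lhs => rw [h]
  simp only [conv, Finset.sum_mul, smul_mul_assoc]
  simp only [← modByMonicHom_apply, map_sum, map_smul]

/-- The `ℓ¹`–`ℓ^∞` bound for cyclic convolution. -/
lemma abs_coeff_conv_le {N : ℕ} (hN : 0 < N) {a b : ℤ[X]} (ha : a.degree < (N : WithBot ℕ))
    (hb : b.degree < (N : WithBot ℕ)) {M : ℤ} (hM : ∀ i, |b.coeff i| ≤ M) (k : ℕ) :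
    |(conv N a b).coeff k| ≤ (∑ i ∈ Finset.range N, |a.coeff i|) * M := by
  rw [conv_eq_sum ha, finsetSum_coeff, Finset.sum_mul]
  refine (Finset.abs_sum_le_sum_abs _ _).trans (Finset.sum_le_sum fun i _ => ?_)
  rw [coeff_smul, smul_eq_mul, abs_mul]
  exact mul_le_mul_of_nonneg_left (abs_coeff_conv_X_pow_le hN hb hM i k) (abs_nonneg _)

lemma Tern.abs_coeff_le_one {N d₁ d₂ : ℕ} {a : ℤ[X]} (ha : Tern N d₁ d₂ a) (i : ℕ) :
    |a.coeff i| ≤ 1 := by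
  rcases ha.2.2.2 i with h | h | h <;> simp [h]

lemma Tern.sum_abs_coeff {N d₁ d₂ : ℕ} {a : ℤ[X]} (ha : Tern N d₁ d₂ a) :
    ∑ i ∈ Finset.range N, |a.coeff i| = d₁ + d₂ := by
  obtain ⟨-, h₁, h₂, h⟩ := ha
  rw [← h₁, ← h₂, Finset.natCast_card_filter, Finset.natCast_card_filter,
    ← Finset.sum_add_distrib]
  refine Finset.sum_congr rfl fun i _ => ?_
  rcases h i with h | h | h <;> simp [h]

end CyclicConvolution

/-- for `g, r ∈ T(d,d)`, `f ∈ T(d+1,d)` and `m` of degree < N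
with all coefficients of absolute value at most `p/2`, every coefficient of
`p·(g ⋆ r) + f ⋆ m` has absolute value at most `(3d + 1/2)·p = (6d+1)·p/2`
(stated as `2·|coeff| ≤ (6d+1)·p`); in particular if `q > (6d+1)·p` then
every coefficient has absolute value strictly less than `q/2`
(stated as `2·|coeff| < q`). -/
theorem master_coeff_bound (N d : ℕ) (hN : 0 < N) (hd : 0 < d) (p : ℤ)
    (hp : 0 < p) (g r f m : ℤ[X]) (hg : Tern N d d g) (hr : Tern N d d r)
    (hf : Tern N (d + 1) d f) (hm : m.degree < (N : WithBot ℕ))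
    (hmc : ∀ i, 2 * |m.coeff i| ≤ p) (k : ℕ) :
    2 * |(C p * conv N g r + conv N f m).coeff k| ≤ (6 * (d : ℤ) + 1) * p ∧
    ∀ q : ℤ, (6 * (d : ℤ) + 1) * p < q →
      2 * |(C p * conv N g r + conv N f m).coeff k| < q := by
  have hgr := abs_coeff_conv_le hN hg.1 hr.1 hr.abs_coeff_le_one k
  have hfm := abs_coeff_conv_le hN hf.1 hm (M := p / 2)
    (fun i => by have := hmc i; omega) k
  rw [hg.sum_abs_coeff, mul_one] at hgr
  rw [hf.sum_abs_coeff] at hfm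
  push_cast at hfm
  have hbound : 2 * |(C p * conv N g r + conv N f m).coeff k| ≤ (6 * (d : ℤ) + 1) * p := by
    rw [coeff_add, coeff_C_mul]
    have htri := abs_add_le (p * (conv N g r).coeff k) ((conv N f m).coeff k)
    rw [abs_mul, abs_of_pos hp] at htri
    have hp2 : 2 * (p / 2) ≤ p := by omega
    have hpgr := mul_le_mul_of_nonneg_left hgr hp.le
    have hpfm := mul_le_mul_of_nonneg_left hp2 (by positivity : (0 : ℤ) ≤ d + 1 + d)
    linarith
  exact ⟨hbound, fun q hq => hbound.trans_lt hq⟩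
end

section
/- (NTRU is not IND-CPA secure: the distinguishing attack) Let N, q, d be positive integers and p an integer, and let h ∈ ℤ[x] satisfy h(1) ≡ 0 (mod q). Let m₀, m₁ ∈ ℤ[x] be two plaintexts with m₀(1) ≢ m₁(1) (mod q). Then for all randomness polynomials r₀, r₁ ∈ T(d,d), the corresponding ciphertexts e₀ ≡ p·(h ⋆ r₀) + m₀ (mod q, x^N − 1) and e₁ ≡ p·(h ⋆ r₁) + m₁ (mod q, x^N − 1) satisfy e₀(1) ≢ e₁(1) (mod q); consequently, given a challenge ciphertext e encrypting m_b for b ∈ {0,1}, the value of e(1) mod q uniquely determines b (it equals m_b(1) mod q). -/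
open Polynomial

/-- The convolution product evaluates multiplicatively at `1`, a root of `x^N − 1`. -/
theorem conv_eval_one {N : ℕ} (hN : 0 < N) (a b : ℤ[X]) :
    (conv N a b).eval 1 = a.eval 1 * b.eval 1 := by
  have hmonic : (X ^ N - 1 : ℤ[X]).Monic := by
    simpa using monic_X_pow_sub_C (1 : ℤ) hN.ne'
  have hdiv := congrArg (eval 1) (modByMonic_add_div (a * b) (X ^ N - 1 : ℤ[X]))
  simpa [conv] using hdiv

/-- Evaluation at `1` is well defined modulo `q` on congruence classes mod `(q, x^N − 1)`. -/
theorem ModCong.eval_one {N : ℕ} {q : ℤ} {u v : ℤ[X]} (huv : ModCong N q u v) :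
    u.eval 1 ≡ v.eval 1 [ZMOD q] := by
  obtain ⟨a, b, hab⟩ := Ideal.mem_span_pair.mp huv
  have heval := congrArg (eval 1) hab
  simp only [eval_add, eval_mul, eval_sub, eval_C, eval_pow, eval_X, Polynomial.eval_one, one_pow,
    sub_self, mul_zero, add_zero] at heval
  exact (Int.modEq_iff_dvd.mpr ⟨a.eval 1, by rw [← heval, mul_comm]⟩).symm

/-- A ciphertext agrees with its plaintext at `1` modulo `q` when `h(1) ≡ 0 (mod q)`. -/
theorem eval_one_ciphertext {N : ℕ} (hN : 0 < N) {q p : ℤ} {h r m e : ℤ[X]}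
    (hh : h.eval 1 ≡ 0 [ZMOD q]) (he : ModCong N q e (C p * conv N h r + m)) :
    e.eval 1 ≡ m.eval 1 [ZMOD q] := by
  have hmask : p * (h.eval 1 * r.eval 1) ≡ 0 [ZMOD q] := by
    simpa using (hh.mul_right (r.eval 1)).mul_left p
  have hcong := he.eval_one
  rw [eval_add, eval_mul, eval_C, conv_eval_one hN] at hcong
  exact hcong.trans (by simpa using hmask.add_right (m.eval 1))

/-- NTRU is not IND-CPA secure: the distinguishing attack:
if `h(1) ≡ 0 (mod q)` and the plaintexts `m₀, m₁` satisfy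
`m₀(1) ≢ m₁(1) (mod q)`, then for all randomness polynomials
`r₀, r₁ ∈ T(d,d)` and corresponding ciphertexts
`eᵢ ≡ p·(h ⋆ rᵢ) + mᵢ (mod q, x^N − 1)`, we have
`e₀(1) ≢ e₁(1) (mod q)`; moreover `eᵢ(1) ≡ mᵢ(1) (mod q)`, so the value of
`e(1) mod q` uniquely determines which plaintext was encrypted. -/
theorem ntru_not_ind_cpa (N d : ℕ) (hN : 0 < N) (hd : 0 < d)
    (q : ℤ) (hq : 0 < q) (p : ℤ) (h m₀ m₁ : ℤ[X])
    (hh : h.eval 1 ≡ 0 [ZMOD q])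
    (hm : ¬ (m₀.eval 1 ≡ m₁.eval 1 [ZMOD q])) :
    ∀ r₀ r₁ e₀ e₁ : ℤ[X], Tern N d d r₀ → Tern N d d r₁ →
      ModCong N q e₀ (C p * conv N h r₀ + m₀) →
      ModCong N q e₁ (C p * conv N h r₁ + m₁) →
      ¬ (e₀.eval 1 ≡ e₁.eval 1 [ZMOD q]) ∧
      e₀.eval 1 ≡ m₀.eval 1 [ZMOD q] ∧
      e₁.eval 1 ≡ m₁.eval 1 [ZMOD q] := by
  intro r₀ r₁ e₀ e₁ _ _ he₀ he₁
  have h₀ := eval_one_ciphertext hN hh he₀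
  have h₁ := eval_one_ciphertext hN hh he₁
  exact ⟨fun heq => hm (h₀.symm.trans (heq.trans h₁)), h₀, h₁⟩
end
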